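/- Let A = (a_{j,q})_{j∈ℕ,q∈ℕ₀} be a Köthe matrix. Then the following are equivalent: (a) (i) for every q∈ℕ₀ there is r∈ℕ₀ with a_{j,r}>0 for all j and Σ_{j=1}^∞ a_{j,q}/a_{j,r} < ∞, (ii) there exist p∈ℕ₀ and C>0 with a_{j,p} ≥ 1/C for all j, and (iii) A² ≺ A; (b) there exists a topological embedding of λ²(A) into s, A ≺ A², and λ²(A) is closed under taking square roots, i.e. for every ξ ∈ λ²(A) with ξ_j ≥ 0 for all j the sequence (√ξ_j)_{j∈ℕ} belongs to λ²(A). -/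

import Mathlib

/-- A Köthe matrix: nonnegative entries, for each `j` some `q` with positive entry,
and increasing in `q`. Indices `j ∈ ℕ` (0-based) and `q ∈ ℕ₀`. -/
def KotheMatrix (a : ℕ → ℕ → ℝ) : Prop :=
  (∀ j q, 0 ≤ a j q) ∧ (∀ j, ∃ q, 0 < a j q) ∧ (∀ j q, a j q ≤ a j (q + 1))

/-- `A ≺ B`: for every `q` there are `r` and `C > 0` with `a j q ≤ C * b j r` for all `j`. -/
def KothePrec (a b : ℕ → ℕ → ℝ) : Prop :=
  ∀ q : ℕ, ∃ r : ℕ, ∃ C : ℝ, 0 < C ∧ ∀ j : ℕ, a j q ≤ C * b j r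

/-- `A ~ B`: `A ≺ B` and `B ≺ A`. -/
def KotheEquiv (a b : ℕ → ℕ → ℝ) : Prop :=
  KothePrec a b ∧ KothePrec b a

/-- The Köthe matrix `A²`, with entries `a j q ^ 2`. -/
def kotheSq (a : ℕ → ℕ → ℝ) : ℕ → ℕ → ℝ := fun j q => a j q ^ 2

/-- The nuclearity condition (Grothendieck–Pietsch): for every `q` there is `r` with
`a j r > 0` for all `j` and `∑ⱼ a j q / a j r < ∞`. -/
def NuclearityCond (a : ℕ → ℕ → ℝ) : Prop :=
  ∀ q : ℕ, ∃ r : ℕ, (∀ j : ℕ, 0 < a j r) ∧ Summable (fun j : ℕ => a j q / a j r)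

/-- Membership in the Köthe space `λ²(A)`. -/
def MemLam2 (a : ℕ → ℕ → ℝ) (ξ : ℕ → ℂ) : Prop :=
  ∀ q : ℕ, Summable (fun j : ℕ => ‖ξ j‖ ^ 2 * a j q ^ 2)

/-- The `q`-th seminorm `|ξ|_{λ²(A),q} = (∑ⱼ |ξ j|² (a j q)²)^{1/2}` of `λ²(A)`. -/
noncomputable def lam2Norm (a : ℕ → ℕ → ℝ) (q : ℕ) (ξ : ℕ → ℂ) : ℝ :=
  Real.sqrt (∑' j : ℕ, ‖ξ j‖ ^ 2 * a j q ^ 2)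

/-- Membership in `ℓ²(ℕ, ℂ)`. -/
def MemEll2 (ξ : ℕ → ℂ) : Prop := Summable (fun j : ℕ => ‖ξ j‖ ^ 2)

/-- The `ℓ²`-norm `‖ξ‖_{ℓ²} = (∑ⱼ |ξ j|²)^{1/2}`. -/
noncomputable def ell2Norm (ξ : ℕ → ℂ) : ℝ := Real.sqrt (∑' j : ℕ, ‖ξ j‖ ^ 2)

/-- The Köthe matrix of the space `s` of rapidly decreasing sequences (0-based indexing,
so the weight is `(j+1)^q`). -/
noncomputable def sMatrix : ℕ → ℕ → ℝ := fun j q => ((j : ℝ) + 1) ^ q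

/-- Membership in the space `s` of rapidly decreasing sequences. -/
def MemS (ξ : ℕ → ℂ) : Prop := MemLam2 sMatrix ξ

/-- The `q`-th norm `|ξ|_q = (∑ⱼ |ξ j|² (j+1)^{2q})^{1/2}` of `s`; note `sNorm 0 = ell2Norm`. -/
noncomputable def sNorm (q : ℕ) (ξ : ℕ → ℂ) : ℝ := lam2Norm sMatrix q ξ

/-- `V` is a topological embedding of the Köthe space `λ²(A)` into `s`
(expressed, as customary for these metrizable locally convex spaces, through the
fundamental systems of seminorms): `V` maps `λ²(A)` into `s`, is injective on `λ²(A)`,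
is continuous, and has continuous inverse on its image. -/
def IsTopEmbeddingIntoS (a : ℕ → ℕ → ℝ) (V : (ℕ → ℂ) →ₗ[ℂ] (ℕ → ℂ)) : Prop :=
  (∀ ξ, MemLam2 a ξ → MemS (V ξ)) ∧
  (∀ ξ, MemLam2 a ξ → V ξ = 0 → ξ = 0) ∧
  (∀ q : ℕ, ∃ r : ℕ, ∃ C : ℝ, 0 < C ∧ ∀ ξ, MemLam2 a ξ → sNorm q (V ξ) ≤ C * lam2Norm a r ξ) ∧
  (∀ q : ℕ, ∃ r : ℕ, ∃ C : ℝ, 0 < C ∧ ∀ ξ, MemLam2 a ξ → lam2Norm a q ξ ≤ C * sNorm r (V ξ))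

theorem KotheMatrix.monotone {a : ℕ → ℕ → ℝ} (hA : KotheMatrix a) (j : ℕ) : Monotone (a j) :=
  monotone_nat_of_le_succ (hA.2.2 j)

theorem lam2Norm_sq (a : ℕ → ℕ → ℝ) (q : ℕ) (ξ : ℕ → ℂ) :
    lam2Norm a q ξ ^ 2 = ∑' j : ℕ, ‖ξ j‖ ^ 2 * a j q ^ 2 :=
  Real.sq_sqrt (tsum_nonneg fun _ => by positivity)

theorem lam2Norm_nonneg (a : ℕ → ℕ → ℝ) (q : ℕ) (ξ : ℕ → ℂ) : 0 ≤ lam2Norm a q ξ :=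
  Real.sqrt_nonneg _

theorem memLam2_of_finset (a : ℕ → ℕ → ℝ) {ξ : ℕ → ℂ} {F : Finset ℕ} (h : ∀ j ∉ F, ξ j = 0) :
    MemLam2 a ξ := fun q =>
  summable_of_ne_finset_zero (s := F) fun j hj => by simp [h j hj]

theorem lam2Norm_sq_of_finset (a : ℕ → ℕ → ℝ) (q : ℕ) {ξ : ℕ → ℂ} {F : Finset ℕ}
    (h : ∀ j ∉ F, ξ j = 0) : lam2Norm a q ξ ^ 2 = ∑ j ∈ F, ‖ξ j‖ ^ 2 * a j q ^ 2 := by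
  rw [lam2Norm_sq, tsum_eq_sum fun j hj => by simp [h j hj]]

theorem memLam2_single (a : ℕ → ℕ → ℝ) (j : ℕ) : MemLam2 a (Pi.single j 1) :=
  memLam2_of_finset a (F := {j}) fun i hi => Pi.single_eq_of_ne (by simpa using hi) _

theorem lam2Norm_single {a : ℕ → ℕ → ℝ} (ha : ∀ j q, 0 ≤ a j q) (q j : ℕ) :
    lam2Norm a q (Pi.single j 1) = a j q := by
  have h : lam2Norm a q (Pi.single j 1) ^ 2 = a j q ^ 2 := by
    rw [lam2Norm_sq_of_finset a q (F := {j})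
      fun i hi => Pi.single_eq_of_ne (by simpa using hi) _]
    simp
  exact (pow_left_inj₀ (lam2Norm_nonneg _ _ _) (ha j q) two_ne_zero).1 h

theorem norm_mul_pow_le_sNorm {η : ℕ → ℂ} (hη : MemS η) (q n : ℕ) :
    ‖η n‖ * ((n : ℝ) + 1) ^ q ≤ sNorm q η := by
  refine le_of_sq_le_sq ?_ (lam2Norm_nonneg _ _ _)
  rw [sNorm, lam2Norm_sq, mul_pow]
  exact (hη q).le_tsum n fun _ _ => by positivity

/-- The dominating norm property of `s`. -/
theorem sNorm_sq_le {η : ℕ → ℂ} (hη : MemS η) (q : ℕ) :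
    sNorm q η ^ 2 ≤ sNorm 0 η * sNorm (2 * q) η := by
  have h0 : 0 ≤ sNorm 0 η := lam2Norm_nonneg _ _ _
  have h2 : 0 ≤ sNorm (2 * q) η := lam2Norm_nonneg _ _ _
  have key := Real.inner_le_Lp_mul_Lq_tsum_of_nonneg (p := 2) (q := 2)
    (f := fun n => ‖η n‖) (g := fun n => ‖η n‖ * sMatrix n (2 * q))
    Real.HolderConjugate.two_two (fun _ => norm_nonneg _)
    (fun n => by unfold sMatrix; positivity)
    (by simpa [sMatrix] using hη 0) (by simpa [mul_pow] using hη (2 * q))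
  have e0 : sNorm 0 η = (∑' n, ‖η n‖ ^ (2 : ℝ)) ^ (1 / (2 : ℝ)) := by
    rw [← Real.sqrt_eq_rpow]; simp [sNorm, lam2Norm, sMatrix]
  have e2 : sNorm (2 * q) η
      = (∑' n, (‖η n‖ * sMatrix n (2 * q)) ^ (2 : ℝ)) ^ (1 / (2 : ℝ)) := by
    rw [← Real.sqrt_eq_rpow]; simp [sNorm, lam2Norm, mul_pow]
  rw [e0, e2, sNorm, lam2Norm_sq]
  refine le_trans (le_of_eq (tsum_congr fun n => ?_)) key
  simp only [sMatrix]; ring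

section Embedding

variable {a : ℕ → ℕ → ℝ} {V : (ℕ → ℂ) →ₗ[ℂ] (ℕ → ℂ)}

/-- A Köthe space that embeds into `s` has a continuous norm. -/
theorem IsTopEmbeddingIntoS.exists_pos (ha : ∀ j q, 0 ≤ a j q) (hV : IsTopEmbeddingIntoS a V) :
    ∃ p, ∀ j, 0 < a j p := by
  obtain ⟨hmem, hinj, hcont, -⟩ := hV
  obtain ⟨p, C, hC, h⟩ := hcont 0
  refine ⟨p, fun j => (ha j p).lt_of_ne' fun h0 => ?_⟩
  have h1 := h _ (memLam2_single a j)
  rw [lam2Norm_single ha, h0, mul_zero] at h1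
  have h2 : V (Pi.single j 1) = 0 := by
    funext n
    have := norm_mul_pow_le_sNorm (hmem _ (memLam2_single a j)) 0 n
    rw [pow_zero, mul_one] at this
    exact norm_le_zero_iff.1 (this.trans h1)
  have h3 := congrFun (hinj _ (memLam2_single a j) h2) j
  simp at h3

/-- A Köthe space that embeds into `s` inherits the dominating norm property. -/
theorem IsTopEmbeddingIntoS.dominating_norm (ha : ∀ j q, 0 ≤ a j q)
    (hV : IsTopEmbeddingIntoS a V) :
    ∃ p, ∀ q, ∃ r C, 0 < C ∧ ∀ j, a j q ^ 2 ≤ C * (a j p * a j r) := by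
  obtain ⟨hmem, -, hcont, hinv⟩ := hV
  obtain ⟨p, C₀, hC₀, h₀⟩ := hcont 0
  refine ⟨p, fun q => ?_⟩
  obtain ⟨k, C₁, hC₁, h₁⟩ := hinv q
  obtain ⟨r, C₂, hC₂, h₂⟩ := hcont (2 * k)
  refine ⟨r, C₁ ^ 2 * (C₀ * C₂), by positivity, fun j => ?_⟩
  have hj := memLam2_single a j
  have e₀ := h₀ _ hj
  have e₁ := h₁ _ hj
  have e₂ := h₂ _ hj
  rw [lam2Norm_single ha] at e₀ e₁ e₂
  calc a j q ^ 2 ≤ (C₁ * sNorm k (V (Pi.single j 1))) ^ 2 := pow_le_pow_left₀ (ha j q) e₁ 2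
    _ = C₁ ^ 2 * sNorm k (V (Pi.single j 1)) ^ 2 := by ring
    _ ≤ C₁ ^ 2 * ((C₀ * a j p) * (C₂ * a j r)) := by
      gcongr
      refine (sNorm_sq_le (hmem _ hj) k).trans ?_
      exact mul_le_mul e₀ e₂ (lam2Norm_nonneg _ _ _) (by have := ha j p; positivity)
    _ = _ := by ring

/-- Continuity of `V` controls the Hilbert space norm of the coordinate functionals of `V`. -/
theorem sum_norm_sq_div_le {p m : ℕ} {C : ℝ} (hpos : ∀ j, 0 < a j p)
    (hmem : ∀ ξ, MemLam2 a ξ → MemS (V ξ))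
    (h : ∀ ξ, MemLam2 a ξ → sNorm m (V ξ) ≤ C * lam2Norm a p ξ) (F : Finset ℕ) (n : ℕ) :
    (∑ j ∈ F, ‖V (Pi.single j 1) n‖ ^ 2 / a j p ^ 2) * (((n : ℝ) + 1) ^ m) ^ 2 ≤ C ^ 2 := by
  set S : ℝ := ∑ j ∈ F, ‖V (Pi.single j 1) n‖ ^ 2 / a j p ^ 2 with hS
  have hS0 : 0 ≤ S := Finset.sum_nonneg fun _ _ => by positivity
  set c : ℕ → ℂ := fun j => starRingEnd ℂ (V (Pi.single j 1) n) / ((a j p ^ 2 : ℝ) : ℂ) with hc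
  set ξ : ℕ → ℂ := ∑ j ∈ F, c j • Pi.single j 1 with hξ
  have hξ_apply : ∀ i, ξ i = if i ∈ F then c i else 0 := fun i => by
    simp [hξ, Finset.sum_apply, Pi.single_apply]
  have hξ0 : ∀ j ∉ F, ξ j = 0 := fun j hj => by simp [hξ_apply, hj]
  have hnorm : lam2Norm a p ξ ^ 2 = S := by
    rw [lam2Norm_sq_of_finset a p hξ0]
    refine Finset.sum_congr rfl fun j hj => ?_
    have := (hpos j).ne'
    rw [hξ_apply, if_pos hj, hc]
    simp only [norm_div, RCLike.norm_conj, Complex.norm_real, Real.norm_eq_abs, abs_pow]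
    rw [abs_of_pos (hpos j)]
    field_simp
  have hval : V ξ n = (S : ℂ) := by
    simp only [hξ, map_sum, map_smul, Finset.sum_apply, Pi.smul_apply, smul_eq_mul, hS,
      Complex.ofReal_sum]
    refine Finset.sum_congr rfl fun j _ => ?_
    rw [hc, div_mul_eq_mul_div, Complex.conj_mul']
    push_cast; rfl
  have hξm := memLam2_of_finset a hξ0
  have h1 := (norm_mul_pow_le_sNorm (hmem ξ hξm) m n).trans (h ξ hξm)
  rw [hval, Complex.norm_real, Real.norm_of_nonneg hS0] at h1
  have h2 := pow_le_pow_left₀ (by positivity) h1 2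
  rw [mul_pow, mul_pow, hnorm] at h2
  rcases hS0.eq_or_lt with h0 | h0
  · rw [← h0, zero_mul]; positivity
  · refine le_of_mul_le_mul_left ?_ h0
    linarith

/-- The identity between suitable local Hilbert spaces of a subspace of `s` is
Hilbert-Schmidt. -/
theorem IsTopEmbeddingIntoS.summable_sq (hA : KotheMatrix a) (hV : IsTopEmbeddingIntoS a V)
    (q : ℕ) : ∃ r, (∀ j, 0 < a j r) ∧ Summable fun j => (a j q / a j r) ^ 2 := by
  obtain ⟨p, hp⟩ := hV.exists_pos hA.1
  obtain ⟨hmem, -, hcont, hinv⟩ := hV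
  obtain ⟨k, C₁, hC₁, h₁⟩ := hinv q
  obtain ⟨r, C₂, hC₂, h₂⟩ := hcont (k + 1)
  have hpos : ∀ j, 0 < a j (max p r) := fun j =>
    (hp j).trans_le (hA.monotone j (le_max_left _ _))
  have h₃ : ∀ ξ, MemLam2 a ξ → sNorm (k + 1) (V ξ) ≤ C₂ * lam2Norm a (max p r) ξ := by
    intro ξ hξ
    refine (h₂ ξ hξ).trans (mul_le_mul_of_nonneg_left (Real.sqrt_le_sqrt ?_) hC₂.le)
    refine (hξ _).tsum_le_tsum (fun j => ?_) (hξ _)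
    have := hA.1 j r
    have := hA.monotone j (le_max_right p r)
    gcongr
  generalize max p r = m at hpos h₃
  refine ⟨m, hpos, ?_⟩
  have hsum : Summable fun n : ℕ => 1 / ((n : ℝ) + 1) ^ 2 := by
    have := (summable_nat_add_iff 1).2 (Real.summable_one_div_nat_pow.2 one_lt_two)
    simpa using this
  refine summable_of_sum_le (c := C₁ ^ 2 * ∑' n : ℕ, C₂ ^ 2 * (1 / ((n : ℝ) + 1) ^ 2))
    (fun _ => by positivity) fun F => ?_
  have hs : ∀ j, Summable fun n =>
      ‖V (Pi.single j 1) n‖ ^ 2 * sMatrix n k ^ 2 / a j m ^ 2 := fun j =>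
    (hmem _ (memLam2_single a j) k).div_const _
  calc ∑ j ∈ F, (a j q / a j m) ^ 2
      ≤ ∑ j ∈ F, C₁ ^ 2 * ∑' n, ‖V (Pi.single j 1) n‖ ^ 2 * sMatrix n k ^ 2 / a j m ^ 2 := by
        refine Finset.sum_le_sum fun j _ => ?_
        have e := h₁ _ (memLam2_single a j)
        rw [lam2Norm_single hA.1] at e
        have e2 := pow_le_pow_left₀ (hA.1 j q) e 2
        rw [mul_pow, sNorm, lam2Norm_sq] at e2
        rw [tsum_div_const, div_pow, ← mul_div_assoc]
        gcongr
    _ = C₁ ^ 2 * ∑' n, ∑ j ∈ F, ‖V (Pi.single j 1) n‖ ^ 2 * sMatrix n k ^ 2 / a j m ^ 2 := by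
        rw [← Finset.mul_sum, Summable.tsum_finsetSum fun j _ => hs j]
    _ ≤ _ := by
        refine mul_le_mul_of_nonneg_left ?_ (by positivity)
        refine (summable_sum fun j _ => hs j).tsum_le_tsum (fun n => ?_) (hsum.mul_left _)
        have e := sum_norm_sq_div_le hpos hmem h₃ F n
        have hn : (0 : ℝ) < (n : ℝ) + 1 := by positivity
        rw [mul_one_div, le_div_iff₀ (by positivity)]
        refine le_trans (le_of_eq ?_) e
        rw [Finset.sum_mul, Finset.sum_mul]
        refine Finset.sum_congr rfl fun j _ => ?_
        simp only [sMatrix]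
        ring

/-- Grothendieck-Pietsch for Köthe spaces that embed into `s`. -/
theorem IsTopEmbeddingIntoS.nuclearityCond (hA : KotheMatrix a)
    (hV : IsTopEmbeddingIntoS a V) : NuclearityCond a := by
  intro q
  obtain ⟨m, hm, hm'⟩ := hV.summable_sq hA q
  obtain ⟨r, hr, hr'⟩ := hV.summable_sq hA m
  refine ⟨r, hr, Summable.of_nonneg_of_le
    (fun j => div_nonneg (hA.1 j q) (hr j).le) (fun j => ?_) (hm'.add hr')⟩
  have e : a j q / a j r = a j q / a j m * (a j m / a j r) := by
    have := (hm j).ne'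
    have := (hr j).ne'
    field_simp
  rw [e]
  nlinarith [sq_nonneg (a j q / a j m - a j m / a j r), sq_nonneg (a j q / a j m),
    sq_nonneg (a j m / a j r)]

end Embedding

/-- A closed-graph type statement, proved with a gliding hump. -/
theorem kothePrec_sq_of_sqrt_closed {a : ℕ → ℕ → ℝ} (hA : KotheMatrix a) {p : ℕ}
    (hp : ∀ j, 0 < a j p)
    (hsqrt : ∀ ξ : ℕ → ℝ, (∀ j, 0 ≤ ξ j) → MemLam2 a (fun j => (ξ j : ℂ)) →
        MemLam2 a (fun j => (Real.sqrt (ξ j) : ℂ))) :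
    KothePrec (kotheSq a) a := by
  intro q
  by_contra hcon
  have hpos : ∀ r j, 0 < a j (p + r) := fun r j =>
    (hp j).trans_le (hA.monotone j (Nat.le_add_right _ _))
  have hfreq : ∀ r, ∃ᶠ j in Filter.atTop, 2 ^ r < a j q ^ 2 / a j (p + r) := by
    intro r hr
    have hb : Filter.IsBoundedUnder (· ≤ ·) Filter.atTop fun j => a j q ^ 2 / a j (p + r) :=
      ⟨2 ^ r, Filter.eventually_map.2 (hr.mono fun j hj => not_lt.1 hj)⟩
    obtain ⟨C, hC⟩ := hb.bddAbove_range
    refine hcon ⟨p + r, max C 1, by positivity, fun j => ?_⟩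
    have := hC ⟨j, rfl⟩
    exact (div_le_iff₀ (hpos r j)).1 (this.trans (le_max_left _ _))
  obtain ⟨φ, hφ, hlt⟩ := Filter.extraction_forall_of_frequently hfreq
  set ξ : ℕ → ℝ := Function.extend φ (fun r => (1 / 2) ^ r / a (φ r) (p + r)) 0 with hξ
  have hξφ : ∀ r, ξ (φ r) = (1 / 2) ^ r / a (φ r) (p + r) := fun r =>
    hφ.injective.extend_apply _ _ r
  have hξ0 : ∀ j ∉ Set.range φ, ξ j = 0 := fun j hj => by
    rw [hξ, Function.extend_apply' _ _ _ (by simpa using hj)]; rfl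
  have hnonneg : ∀ j, 0 ≤ ξ j := fun j => by
    by_cases hj : j ∈ Set.range φ
    · obtain ⟨r, rfl⟩ := hj
      have := hpos r (φ r)
      rw [hξφ]; positivity
    · exact (hξ0 j hj).ge
  have hmem : MemLam2 a fun j => (ξ j : ℂ) := by
    intro m
    refine (hφ.injective.summable_iff fun j hj => by simp [hξ0 j hj]).1 ?_
    have hg : Summable fun r : ℕ => ((1 / 2 : ℝ) ^ 2) ^ r :=
      summable_geometric_of_lt_one (by norm_num) (by norm_num)
    refine hg.of_norm_bounded_eventually_nat ?_
    filter_upwards [Filter.eventually_ge_atTop m] with r hr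
    have h1 := hpos r (φ r)
    have h2 : a (φ r) m ≤ a (φ r) (p + r) := hA.monotone _ (by omega)
    have h3 := hA.1 (φ r) m
    simp only [Function.comp, hξφ, Complex.norm_real, Real.norm_eq_abs, sq_abs]
    rw [abs_of_nonneg (by positivity), ← pow_mul, mul_comm 2 r, pow_mul, ← mul_pow]
    gcongr
    rw [div_mul_eq_mul_div, div_le_iff₀ h1]
    gcongr
  have hs := (hsqrt ξ hnonneg hmem q).comp_injective hφ.injective
  have htend := hs.tendsto_atTop_zero
  obtain ⟨r, hr⟩ := (htend.eventually (gt_mem_nhds one_pos)).exists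
  refine hr.not_ge ?_
  have h1 := hpos r (φ r)
  simp only [Function.comp, Complex.norm_real, Real.norm_eq_abs, sq_abs]
  rw [Real.sq_sqrt (hnonneg _), hξφ]
  calc (1 : ℝ) = (1 / 2) ^ r * 2 ^ r := by rw [← mul_pow]; norm_num
    _ ≤ (1 / 2) ^ r * (a (φ r) q ^ 2 / a (φ r) (p + r)) := by
      have := (hlt r).le
      gcongr
    _ = _ := by ring

/-- The dominating norm property together with `A ≺ A²` bounds some column away from zero. -/
theorem KotheMatrix.exists_lower_bound {a : ℕ → ℕ → ℝ} (hA : KotheMatrix a) {p₀ : ℕ}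
    (hp₀ : ∀ j, 0 < a j p₀)
    (hdn : ∃ p, ∀ q, ∃ r C, 0 < C ∧ ∀ j, a j q ^ 2 ≤ C * (a j p * a j r))
    (hsq : KothePrec a (kotheSq a)) : ∃ p : ℕ, ∃ C : ℝ, 0 < C ∧ ∀ j : ℕ, 1 / C ≤ a j p := by
  obtain ⟨p, hdn⟩ := hdn
  obtain ⟨s, D, hD, hs⟩ := hsq (max p p₀)
  obtain ⟨r, C, hC, hr⟩ := hdn s
  refine ⟨r, D * C, by positivity, fun j => ?_⟩
  have h1 : 0 < a j (max p p₀) := (hp₀ j).trans_le (hA.monotone j (le_max_right _ _))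
  have h2 := hs j
  have h3 := hr j
  have h4 : a j p ≤ a j (max p p₀) := hA.monotone j (le_max_left _ _)
  have h7 : a j (max p p₀) ≤ D * (C * (a j p * a j r)) := h2.trans (by
    simp only [kotheSq]; gcongr)
  have h5 : 0 ≤ a j r := hA.1 j r
  rw [div_le_iff₀ (by positivity)]
  refine le_of_mul_le_mul_left ?_ h1
  calc a j (max p p₀) * 1 ≤ D * (C * (a j p * a j r)) := by rwa [mul_one]
    _ ≤ D * (C * (a j (max p p₀) * a j r)) := by gcongr
    _ = _ := by ring

theorem KotheMatrix.kothePrec_sq_of_lower_bound {a : ℕ → ℕ → ℝ} (hA : KotheMatrix a)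
    (hlow : ∃ p : ℕ, ∃ C : ℝ, 0 < C ∧ ∀ j : ℕ, 1 / C ≤ a j p) : KothePrec a (kotheSq a) := by
  obtain ⟨p, C, hC, hp⟩ := hlow
  intro q
  refine ⟨max p q, C, hC, fun j => ?_⟩
  have h1 := (div_le_iff₀ hC).1 ((hp j).trans (hA.monotone j (le_max_left p q)))
  have h2 := hA.monotone j (le_max_right p q)
  have h3 := hA.1 j (max p q)
  simp only [kotheSq]
  nlinarith

theorem memLam2_sqrt {a : ℕ → ℕ → ℝ} (hnuc : NuclearityCond a) (hsq : KothePrec (kotheSq a) a)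
    {ξ : ℕ → ℝ} (hξ : ∀ j, 0 ≤ ξ j) (hmem : MemLam2 a fun j => (ξ j : ℂ)) :
    MemLam2 a fun j => (Real.sqrt (ξ j) : ℂ) := by
  intro q
  obtain ⟨r, C, hC, hr⟩ := hsq q
  obtain ⟨t, ht, hs⟩ := hnuc r
  have hbdd : Filter.IsBoundedUnder (· ≤ ·) Filter.atTop
      fun j => ‖(ξ j : ℂ)‖ ^ 2 * a j t ^ 2 := (hmem t).tendsto_atTop_zero.isBoundedUnder_le
  obtain ⟨B, hB⟩ := hbdd.bddAbove_range
  refine Summable.of_nonneg_of_le (fun _ => by positivity) (fun j => ?_)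
    (hs.mul_left (C * (B + 1)))
  have hb := hB ⟨j, rfl⟩
  simp only [Complex.norm_real, Real.norm_eq_abs, sq_abs] at hb ⊢
  rw [Real.sq_sqrt (hξ j)]
  have h1 : ξ j * a j t ≤ B + 1 := by nlinarith [sq_nonneg (ξ j * a j t - 1)]
  have h2 := hr j
  simp only [kotheSq] at h2
  have h3 := ht j
  have h4 : 0 ≤ a j r := by
    by_contra hn
    nlinarith [sq_nonneg (a j q)]
  calc ξ j * a j q ^ 2 ≤ ξ j * (C * a j r) := mul_le_mul_of_nonneg_left h2 (hξ j)
    _ = C * (ξ j * a j t) * (a j r / a j t) := by field_simp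
    _ ≤ _ := by gcongr

/-- The sequence `f` is dominated by a multiple of some column of the matrix `a`. -/
def KotheDominated (a : ℕ → ℕ → ℝ) (f : ℕ → ℝ) : Prop :=
  ∃ r : ℕ, ∃ C : ℝ, 0 < C ∧ ∀ j : ℕ, f j ≤ C * a j r

namespace KotheDominated

variable {a : ℕ → ℕ → ℝ} {f g : ℕ → ℝ}

theorem mono (hg : KotheDominated a g) (h : ∀ j, f j ≤ g j) : KotheDominated a f := by
  obtain ⟨r, C, hC, hr⟩ := hg
  exact ⟨r, C, hC, fun j => (h j).trans (hr j)⟩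

theorem column (a : ℕ → ℕ → ℝ) (q : ℕ) : KotheDominated a fun j => a j q :=
  ⟨q, 1, one_pos, fun _ => (one_mul _).ge⟩

theorem const (hlow : ∃ p : ℕ, ∃ C : ℝ, 0 < C ∧ ∀ j : ℕ, 1 / C ≤ a j p) (c : ℝ) :
    KotheDominated a fun _ => c := by
  obtain ⟨p, C, hC, hp⟩ := hlow
  refine ⟨p, (|c| + 1) * C, by positivity, fun j => ?_⟩
  have h := (div_le_iff₀ hC).1 (hp j)
  nlinarith [le_abs_self c, abs_nonneg c]

theorem add (hA : KotheMatrix a) (hf : KotheDominated a f) (hg : KotheDominated a g) :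
    KotheDominated a fun j => f j + g j := by
  obtain ⟨r, C, hC, hr⟩ := hf
  obtain ⟨s, D, hD, hs⟩ := hg
  refine ⟨max r s, C + D, by positivity, fun j => ?_⟩
  have h1 := mul_le_mul_of_nonneg_left (hA.monotone j (le_max_left r s)) hC.le
  have h2 := mul_le_mul_of_nonneg_left (hA.monotone j (le_max_right r s)) hD.le
  linarith [hr j, hs j]

theorem mul (hA : KotheMatrix a) (hsq : KothePrec (kotheSq a) a) (hg0 : ∀ j, 0 ≤ g j)
    (hf : KotheDominated a f) (hg : KotheDominated a g) :
    KotheDominated a fun j => f j * g j := by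
  obtain ⟨r, C, hC, hr⟩ := hf
  obtain ⟨s, D, hD, hs⟩ := hg
  obtain ⟨t, E, hE, ht⟩ := hsq (max r s)
  refine ⟨t, C * D * E, by positivity, fun j => ?_⟩
  have h0 := hA.1 j (max r s)
  have h1 := mul_le_mul_of_nonneg_left (hA.monotone j (le_max_left r s)) hC.le
  have h2 := mul_le_mul_of_nonneg_left (hA.monotone j (le_max_right r s)) hD.le
  calc f j * g j ≤ (C * a j (max r s)) * (D * a j (max r s)) :=
        mul_le_mul ((hr j).trans h1) ((hs j).trans h2) (hg0 j) (by positivity)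
    _ = C * D * kotheSq a j (max r s) := by simp only [kotheSq]; ring
    _ ≤ C * D * (E * a j t) := by have := ht j; gcongr
    _ = _ := by ring

theorem pow (hA : KotheMatrix a) (hsq : KothePrec (kotheSq a) a)
    (hlow : ∃ p : ℕ, ∃ C : ℝ, 0 < C ∧ ∀ j : ℕ, 1 / C ≤ a j p) (hf0 : ∀ j, 0 ≤ f j)
    (hf : KotheDominated a f) (n : ℕ) : KotheDominated a fun j => f j ^ n := by
  induction n with
  | zero => simpa using const hlow 1
  | succ n ih => simpa only [pow_succ] using mul hA hsq hf0 ih hf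

theorem sum (hA : KotheMatrix a)
    (hlow : ∃ p : ℕ, ∃ C : ℝ, 0 < C ∧ ∀ j : ℕ, 1 / C ≤ a j p) {u : ℕ → ℕ → ℝ} (F : Finset ℕ)
    (hu : ∀ k ∈ F, KotheDominated a fun j => u j k) :
    KotheDominated a fun j => ∑ k ∈ F, u j k := by
  induction F using Finset.induction_on with
  | empty => simpa using const hlow 0
  | insert k F hk ih =>
    simp only [Finset.sum_insert hk]
    exact add hA (hu k (by simp)) (ih fun i hi => hu i (by simp [hi]))

theorem natCeil (hA : KotheMatrix a)
    (hlow : ∃ p : ℕ, ∃ C : ℝ, 0 < C ∧ ∀ j : ℕ, 1 / C ≤ a j p) (hf0 : ∀ j, 0 ≤ f j)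
    (hf : KotheDominated a f) : KotheDominated a fun j => (⌈f j⌉₊ : ℝ) :=
  mono (add hA hf (const hlow 1)) fun j => (Nat.ceil_lt_add_one (hf0 j)).le

theorem natPair (hA : KotheMatrix a) (hsq : KothePrec (kotheSq a) a)
    (hlow : ∃ p : ℕ, ∃ C : ℝ, 0 < C ∧ ∀ j : ℕ, 1 / C ≤ a j p) {m n : ℕ → ℕ}
    (hm : KotheDominated a fun j => (m j : ℝ)) (hn : KotheDominated a fun j => (n j : ℝ)) :
    KotheDominated a fun j => (Nat.pair (m j) (n j) : ℝ) := by
  refine mono (pow hA hsq hlow (fun _ => ?_) (add hA (add hA hm hn) (const hlow 1)) 2)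
    fun j => ?_
  · positivity
  · have h1 := (Nat.pair_lt_max_add_one_sq (m j) (n j)).le
    have h2 : (max (m j) (n j) + 1) ^ 2 ≤ (m j + n j + 1) ^ 2 :=
      Nat.pow_le_pow_left (by omega) 2
    exact_mod_cast h1.trans h2

/-- Summability of reciprocals allows one to enumerate the indices at polynomial cost. -/
theorem exists_injective (hA : KotheMatrix a) (hsq : KothePrec (kotheSq a) a)
    (hlow : ∃ p : ℕ, ∃ C : ℝ, 0 < C ∧ ∀ j : ℕ, 1 / C ≤ a j p) (hnuc : NuclearityCond a) :
    ∃ ρ : ℕ → ℕ, Function.Injective ρ ∧ KotheDominated a fun j => (ρ j : ℝ) := by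
  obtain ⟨p, C, hC, hp⟩ := id hlow
  obtain ⟨r, hr, hs⟩ := hnuc p
  have hsum : Summable fun j => 1 / a j r := by
    refine Summable.of_nonneg_of_le (fun j => by have := hr j; positivity) (fun j => ?_)
      (hs.mul_left C)
    have := hr j
    rw [← mul_div_assoc]
    gcongr
    have h := (div_le_iff₀ hC).1 (hp j)
    linarith
  set m : ℕ → ℕ := fun j => ⌈a j r⌉₊ with hm
  set t : ℕ → Finset ℕ := fun j => {i ∈ Finset.range j | m i = m j} with ht
  have hmpos : ∀ j, (0 : ℝ) < m j := fun j => (hr j).trans_le (Nat.le_ceil _)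
  have hdm : KotheDominated a fun j => (m j : ℝ) :=
    natCeil hA hlow (fun j => hA.1 j r) (column a r)
  refine ⟨fun j => Nat.pair (m j) (t j).card, fun i j hij => ?_, natPair hA hsq hlow hdm ?_⟩
  · obtain ⟨h1, h2⟩ := Nat.pair_eq_pair.1 hij
    have key : ∀ i j, m i = m j → i < j → (t i).card < (t j).card := fun i j h hlt => by
      refine Finset.card_lt_card (Finset.ssubset_iff_of_subset (fun l hl => ?_) |>.2 ⟨i, ?_⟩)
      · simp only [ht, Finset.mem_filter, Finset.mem_range] at hl ⊢
        exact ⟨hl.1.trans hlt, hl.2.trans h⟩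
      · simp [ht, h, hlt]
    rcases lt_trichotomy i j with h | h | h
    · exact absurd h2 (key i j h1 h).ne
    · exact h
    · exact absurd h2 (key j i h1.symm h).ne'
  · refine mono (mul hA hsq (fun j => (hmpos j).le) (const hlow (∑' i, 1 / a i r)) hdm)
      fun j => ?_
    rw [← div_le_iff₀ (hmpos j)]
    calc ((t j).card : ℝ) / m j = ∑ i ∈ t j, 1 / (m j : ℝ) := by simp [div_eq_mul_inv]
      _ ≤ ∑ i ∈ t j, 1 / a i r := by
        refine Finset.sum_le_sum fun i hi => one_div_le_one_div_of_le (hr i) ?_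
        rw [← (Finset.mem_filter.1 hi).2]
        exact Nat.le_ceil _
      _ ≤ _ := hsum.sum_le_tsum _ fun i _ => by have := hr i; positivity

end KotheDominated

/-- The diagonal-type linear map sending the `j`-th unit vector to
`∑ₖ c (j, k) • e_{N (j, k)}`. -/
noncomputable def spreadMap (N : ℕ × ℕ → ℕ) (c : ℕ × ℕ → ℝ) : (ℕ → ℂ) →ₗ[ℂ] (ℕ → ℂ) where
  toFun ξ := Function.extend N (fun x => (c x : ℂ) * ξ x.1) 0
  map_add' ξ η := by
    rw [← Function.extend_add, add_zero]
    congr 1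
    funext x
    simp [mul_add]
  map_smul' z ξ := by
    rw [RingHom.id_apply, ← Function.extend_smul, smul_zero]
    congr 1
    funext x
    simp only [Pi.smul_apply, smul_eq_mul]
    ring

section SpreadMap

variable {a : ℕ → ℕ → ℝ} {N : ℕ × ℕ → ℕ} {c : ℕ × ℕ → ℝ}

theorem spreadMap_apply (hN : Function.Injective N) (ξ : ℕ → ℂ) (x : ℕ × ℕ) :
    spreadMap N c ξ (N x) = c x * ξ x.1 :=
  hN.extend_apply (fun x => (c x : ℂ) * ξ x.1) 0 x

theorem spreadMap_apply_of_notMem (ξ : ℕ → ℂ) {n : ℕ} (hn : n ∉ Set.range N) :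
    spreadMap N c ξ n = 0 :=
  Function.extend_apply' (fun x => (c x : ℂ) * ξ x.1) (0 : ℕ → ℂ) n hn

theorem summable_spreadMap_iff (hN : Function.Injective N) (q : ℕ) (ξ : ℕ → ℂ) :
    (Summable fun n => ‖spreadMap N c ξ n‖ ^ 2 * sMatrix n q ^ 2) ↔
      Summable fun x : ℕ × ℕ => ‖ξ x.1‖ ^ 2 * (c x * sMatrix (N x) q) ^ 2 := by
  rw [← hN.summable_iff fun n hn => by simp [spreadMap_apply_of_notMem ξ hn]]
  refine summable_congr fun x => ?_
  simp only [Function.comp, spreadMap_apply hN, norm_mul, Complex.norm_real, Real.norm_eq_abs,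
    mul_pow, sq_abs]
  ring

theorem sNorm_spreadMap_sq (hN : Function.Injective N) (q : ℕ) (ξ : ℕ → ℂ) :
    sNorm q (spreadMap N c ξ) ^ 2 =
      ∑' x : ℕ × ℕ, ‖ξ x.1‖ ^ 2 * (c x * sMatrix (N x) q) ^ 2 := by
  rw [sNorm, lam2Norm_sq, ← hN.tsum_eq]
  · refine tsum_congr fun x => ?_
    simp only [spreadMap_apply hN, norm_mul, Complex.norm_real, Real.norm_eq_abs,
      mul_pow, sq_abs]
    ring
  · intro n hn
    by_contra h
    exact hn (by simp [spreadMap_apply_of_notMem ξ h])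

theorem isTopEmbeddingIntoS_spreadMap (hN : Function.Injective N) (hc : ∀ x, 0 ≤ c x)
    (hpos : ∀ j, ∃ k, 0 < c (j, k))
    (hupper : ∀ q, ∃ r C, 0 < C ∧ ∀ j k, c (j, k) * sMatrix (N (j, k)) q ≤
      C * a j r * (1 / 2) ^ k)
    (hlower : ∀ q, ∃ r k, ∀ j, 0 ≤ a j q ∧ a j q ≤ c (j, k) * sMatrix (N (j, k)) r) :
    IsTopEmbeddingIntoS a (spreadMap N c) := by
  have hs0 : ∀ n q, 0 ≤ sMatrix n q := fun n q => by unfold sMatrix; positivity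
  have hgeo : Summable fun k : ℕ => ((1 / 2 : ℝ) ^ k) ^ 2 := by
    simp_rw [← pow_mul, mul_comm _ 2, pow_mul]
    exact summable_geometric_of_lt_one (by norm_num) (by norm_num)
  have hbound : ∀ {q r : ℕ} {C : ℝ}, (∀ j k, c (j, k) * sMatrix (N (j, k)) q ≤
      C * a j r * (1 / 2) ^ k) → ∀ (ξ : ℕ → ℂ) (x : ℕ × ℕ),
      ‖ξ x.1‖ ^ 2 * (c x * sMatrix (N x) q) ^ 2 ≤
        C ^ 2 * (‖ξ x.1‖ ^ 2 * a x.1 r ^ 2 * ((1 / 2) ^ x.2) ^ 2) := fun {q r C} h ξ x => by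
    have h1 := pow_le_pow_left₀ (mul_nonneg (hc x) (hs0 _ q)) (h x.1 x.2) 2
    refine (mul_le_mul_of_nonneg_left h1 (sq_nonneg ‖ξ x.1‖)).trans (le_of_eq ?_)
    ring
  have hprod : ∀ {r : ℕ} {ξ : ℕ → ℂ}, MemLam2 a ξ → Summable fun x : ℕ × ℕ =>
      ‖ξ x.1‖ ^ 2 * a x.1 r ^ 2 * ((1 / 2 : ℝ) ^ x.2) ^ 2 := fun {r ξ} hξ =>
    (hξ r).mul_of_nonneg hgeo (fun _ => by positivity) (fun _ => by positivity)
  have hsumm : ∀ {ξ : ℕ → ℂ}, MemLam2 a ξ → ∀ q, Summable fun x : ℕ × ℕ =>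
      ‖ξ x.1‖ ^ 2 * (c x * sMatrix (N x) q) ^ 2 := fun {ξ} hξ q => by
    obtain ⟨r, C, -, h⟩ := hupper q
    exact Summable.of_nonneg_of_le (fun _ => by positivity) (hbound h ξ)
      ((hprod hξ).mul_left _)
  refine ⟨fun ξ hξ q => (summable_spreadMap_iff hN q ξ).2 (hsumm hξ q), fun ξ _ h0 => ?_,
    fun q => ?_, fun q => ?_⟩
  · funext j
    obtain ⟨k, hk⟩ := hpos j
    have h := congrFun h0 (N (j, k))
    rw [spreadMap_apply hN, Pi.zero_apply, mul_eq_zero, Complex.ofReal_eq_zero] at h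
    exact h.resolve_left hk.ne'
  · obtain ⟨r, C, hC, h⟩ := hupper q
    set G : ℝ := ∑' k : ℕ, ((1 / 2 : ℝ) ^ k) ^ 2 with hG
    have hG0 : 0 ≤ G := tsum_nonneg fun _ => by positivity
    refine ⟨r, C * (G + 1), by positivity, fun ξ hξ => ?_⟩
    have hl := lam2Norm_nonneg a r ξ
    refine le_of_sq_le_sq ?_ (by positivity)
    calc sNorm q (spreadMap N c ξ) ^ 2
        ≤ C ^ 2 * (lam2Norm a r ξ ^ 2 * G) := by
          rw [sNorm_spreadMap_sq hN, lam2Norm_sq, hG,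
            (hξ r).tsum_mul_tsum hgeo (hprod hξ), ← tsum_mul_left]
          exact (hsumm hξ q).tsum_le_tsum (hbound h ξ) ((hprod hξ).mul_left _)
      _ ≤ C ^ 2 * (lam2Norm a r ξ ^ 2 * (G + 1) ^ 2) := by
          gcongr
          nlinarith
      _ = _ := by ring
  · obtain ⟨r, k, h⟩ := hlower q
    refine ⟨r, 1, one_pos, fun ξ hξ => ?_⟩
    rw [one_mul]
    refine le_of_sq_le_sq ?_ (lam2Norm_nonneg _ _ _)
    have hinj : Function.Injective fun j : ℕ => (j, k) := fun i j hij => (Prod.ext_iff.1 hij).1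
    rw [sNorm_spreadMap_sq hN, lam2Norm_sq]
    refine ((hξ q).tsum_le_tsum (fun j => ?_) ((hsumm hξ r).comp_injective hinj)).trans
      (tsum_comp_le_tsum_of_inj (hsumm hξ r) (fun _ => by positivity) hinj)
    have h1 := (h j).1
    have h2 := (h j).2
    simp only [Function.comp]
    gcongr

end SpreadMap

theorem exists_isTopEmbeddingIntoS {a : ℕ → ℕ → ℝ} (hA : KotheMatrix a)
    (hnuc : NuclearityCond a)
    (hlow : ∃ p : ℕ, ∃ C : ℝ, 0 < C ∧ ∀ j : ℕ, 1 / C ≤ a j p)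
    (hsq : KothePrec (kotheSq a) a) :
    ∃ V : (ℕ → ℂ) →ₗ[ℂ] (ℕ → ℂ), IsTopEmbeddingIntoS a V := by
  obtain ⟨ρ, hρ, hdρ⟩ := KotheDominated.exists_injective hA hsq hlow hnuc
  set N : ℕ × ℕ → ℕ := fun x => Nat.pair (Nat.pair x.2 (ρ x.1)) ⌈2 ^ x.2 * a x.1 x.2⌉₊ with hN
  have hNinj : Function.Injective N := fun x y hxy => by
    obtain ⟨h1, h2⟩ := Nat.pair_eq_pair.1 (Nat.pair_eq_pair.1 hxy).1
    exact Prod.ext (hρ h2) h1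
  have hMpos : ∀ x, (0 : ℝ) < (N x : ℝ) + 1 := fun x => by positivity
  have hMge : ∀ x : ℕ × ℕ, 2 ^ x.2 * a x.1 x.2 ≤ (N x : ℝ) + 1 := fun x =>
    ((Nat.le_ceil _).trans (Nat.cast_le.2 (Nat.right_le_pair (Nat.pair x.2 (ρ x.1)) _))).trans
      (le_add_of_nonneg_right zero_le_one)
  have hMdom : ∀ k, KotheDominated a fun j => (N (j, k) : ℝ) + 1 := fun k => by
    refine .add hA (.natPair hA hsq hlow (.natPair hA hsq hlow (.const hlow (k : ℝ)) hdρ)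
      (.natCeil hA hlow (fun j => ?_) ?_)) (.const hlow 1)
    · have := hA.1 j k
      positivity
    · exact .mul hA hsq (fun j => hA.1 j k) (.const hlow (2 ^ k)) (.column a k)
  refine ⟨_, isTopEmbeddingIntoS_spreadMap (c := fun x => a x.1 x.2 / ((N x : ℝ) + 1) ^ x.2)
    hNinj (fun x => div_nonneg (hA.1 _ _) (pow_pos (hMpos x) _).le) (fun j => ?_) (fun q => ?_)
    fun q => ⟨q, q, fun j => ⟨hA.1 j q, ?_⟩⟩⟩
  · obtain ⟨k, hk⟩ := hA.2.1 j
    exact ⟨k, div_pos hk (pow_pos (hMpos _) _)⟩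
  · have hdom : KotheDominated a fun j =>
        (∑ k ∈ Finset.range (q + 1), 2 ^ k * (a j k * ((N (j, k) : ℝ) + 1) ^ q)) + 1 := by
      refine .add hA (.sum hA hlow _ fun k _ => ?_) (.const hlow 1)
      have hpow := KotheDominated.pow hA hsq hlow (fun j => (hMpos (j, k)).le) (hMdom k) q
      refine .mul hA hsq (fun j => ?_) (.const hlow _)
        (.mul hA hsq (fun j => ?_) (.column a k) hpow)
      · exact mul_nonneg (hA.1 j k) (pow_pos (hMpos _) _).le
      · exact (pow_pos (hMpos _) _).le
    obtain ⟨r, C, hC, hr⟩ := hdom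
    refine ⟨r, C, hC, fun j k => le_trans ?_ (mul_le_mul_of_nonneg_right (hr j) (by positivity))⟩
    have hterm : ∀ i, 0 ≤ 2 ^ i * (a j i * ((N (j, i) : ℝ) + 1) ^ q) := fun i =>
      mul_nonneg (by positivity) (mul_nonneg (hA.1 j i) (pow_pos (hMpos _) _).le)
    have hM := hMpos (j, k)
    have hM1 : (1 : ℝ) ≤ (N (j, k) : ℝ) + 1 := by simp
    have hge := hMge (j, k)
    have ha := hA.1 j k
    simp only [sMatrix] at hge ⊢
    generalize hM_def : (N (j, k) : ℝ) + 1 = M at hM hM1 hge ⊢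
    rw [one_div, inv_pow, ← div_eq_mul_inv, le_div_iff₀ (by positivity)]
    rcases le_or_gt k q with hkq | hkq
    · have h1 := Finset.single_le_sum (fun i _ => hterm i)
        (Finset.mem_range.2 (Nat.lt_succ_of_le hkq))
      refine le_trans ?_ (h1.trans (le_add_of_nonneg_right zero_le_one))
      rw [mul_comm]
      gcongr
      · exact div_le_self ha (one_le_pow₀ hM1)
      · exact hM_def.ge
    · have h1 : a j k / M ^ k * M ^ q * 2 ^ k ≤ 1 := by
        rw [div_mul_eq_mul_div, div_mul_eq_mul_div, div_le_one (by positivity)]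
        calc a j k * M ^ q * 2 ^ k = 2 ^ k * a j k * M ^ q := by ring
          _ ≤ M * M ^ q := by gcongr
          _ = M ^ (q + 1) := by ring
          _ ≤ M ^ k := pow_le_pow_right₀ hM1 hkq
      exact h1.trans (le_add_of_nonneg_left (Finset.sum_nonneg fun i _ => hterm i))
  · have := hMpos (j, q)
    simp only [sMatrix]
    rw [div_mul_cancel₀ _ (by positivity)]

/-- conditions (i), (ii), (iii) of set (4) hold if and only if `λ²(A)` embeds
topologically into `s`, `A ≺ A²`, and `λ²(A)` is closed under taking square roots. -/
theorem statement17 (a : ℕ → ℕ → ℝ) (hA : KotheMatrix a) :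
    (NuclearityCond a ∧
      (∃ p : ℕ, ∃ C : ℝ, 0 < C ∧ ∀ j : ℕ, 1 / C ≤ a j p) ∧
      KothePrec (kotheSq a) a) ↔
    ((∃ V : (ℕ → ℂ) →ₗ[ℂ] (ℕ → ℂ), IsTopEmbeddingIntoS a V) ∧
      KothePrec a (kotheSq a) ∧
      (∀ ξ : ℕ → ℝ, (∀ j, 0 ≤ ξ j) → MemLam2 a (fun j => (ξ j : ℂ)) →
        MemLam2 a (fun j => (Real.sqrt (ξ j) : ℂ)))) := by
  constructor
  · rintro ⟨hnuc, hlow, hsq⟩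
    refine ⟨exists_isTopEmbeddingIntoS hA hnuc hlow hsq, hA.kothePrec_sq_of_lower_bound hlow,
      fun ξ hξ hmem => memLam2_sqrt hnuc hsq hξ hmem⟩
  · rintro ⟨⟨V, hV⟩, hsq, hsqrt⟩
    obtain ⟨p, hp⟩ := hV.exists_pos hA.1
    exact ⟨hV.nuclearityCond hA, hA.exists_lower_bound hp (hV.dominating_norm hA.1) hsq,
      kothePrec_sq_of_sqrt_closed hA hp hsqrt⟩
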